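/- (Lemma 1) Let I be a nonempty finite index set and for each i ∈ I let τᵢ > 0, defining fᵢ(t) = t · log₂(1 + τᵢ/t) for t > 0. Let T > 0 and let ε₁ > 0, ε₂ > 0 be real numbers with ε₂ < T and fᵢ(2ε₂) < ε₁ for all i ∈ I. Then there exists a positive constant σ such that σ < ε₁ and, for all i ∈ I and all real numbers t_A, t_B with 0 < t_B, t_A ≤ T and ε₂ ≤ t_A − t_B, one has σ < fᵢ(t_A) − fᵢ(t_B). -/

import Mathlib

/-- The slope at `t` of `t ↦ t * Real.log (1 + τ / t)`. -/
noncomputable def rateSlope (τ t : ℝ) : ℝ := Real.log (1 + τ / t) - τ / (t + τ)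

theorem log_one_add_div_sub_le {τ s t : ℝ} (hτ : 0 < τ) (hs : 0 < s) (ht : 0 < t) :
    Real.log (1 + τ / s) - Real.log (1 + τ / t) ≤ τ * (t - s) / (s * (t + τ)) := by
  have hs' : 0 < 1 + τ / s := by positivity
  have ht' : 0 < 1 + τ / t := by positivity
  rw [← Real.log_div hs'.ne' ht'.ne']
  refine (Real.log_le_sub_one_of_pos (div_pos hs' ht')).trans_eq ?_
  field_simp
  ring

theorem rateSlope_pos {τ t : ℝ} (hτ : 0 < τ) (ht : 0 < t) : 0 < rateSlope τ t := by
  have hpos : 0 < 1 + τ / t := by positivity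
  have hne : (1 + τ / t)⁻¹ ≠ 1 := by
    rw [ne_eq, inv_eq_one]
    exact (lt_add_of_pos_right 1 (div_pos hτ ht)).ne'
  have hlog := Real.log_lt_sub_one_of_pos (inv_pos.mpr hpos) hne
  have hinv : (1 + τ / t)⁻¹ - 1 = -(τ / (t + τ)) := by
    field_simp
    ring
  rw [Real.log_inv, hinv] at hlog
  unfold rateSlope
  linarith

theorem rateSlope_anti {τ s t : ℝ} (hτ : 0 < τ) (hs : 0 < s) (hst : s ≤ t) :
    rateSlope τ t ≤ rateSlope τ s := by
  have ht : 0 < t := hs.trans_le hst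
  have hlog := log_one_add_div_sub_le hτ ht hs
  have hle : τ * (s - t) / (t * (s + τ)) ≤ τ / (t + τ) - τ / (s + τ) := by
    have hdiff : τ / (t + τ) - τ / (s + τ) - τ * (s - t) / (t * (s + τ)) =
        τ ^ 2 * (t - s) / (t * (t + τ) * (s + τ)) := by
      field_simp
      ring
    have : 0 ≤ τ ^ 2 * (t - s) / (t * (t + τ) * (s + τ)) :=
      div_nonneg (mul_nonneg (sq_nonneg τ) (sub_nonneg.mpr hst)) (by positivity)
    linarith
  unfold rateSlope
  linarith

theorem sub_mul_rateSlope_le {τ s t : ℝ} (hτ : 0 < τ) (hs : 0 < s) (ht : 0 < t) :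
    (t - s) * rateSlope τ t ≤ t * Real.log (1 + τ / t) - s * Real.log (1 + τ / s) := by
  have hlog := mul_le_mul_of_nonneg_left (log_one_add_div_sub_le hτ hs ht) hs.le
  have hcancel : s * (τ * (t - s) / (s * (t + τ))) = (t - s) * (τ / (t + τ)) := by
    field_simp
  rw [hcancel] at hlog
  unfold rateSlope
  linarith


/-- Lemma 1 of the paper.  For a nonempty finite index set `I`, parameters
`τ i > 0` defining `f i t = t · log₂(1 + τ i / t)`, a frame length `T > 0` and
hyper-parameters `ε₁, ε₂ > 0` with `ε₂ < T` and `f i (2ε₂) < ε₁` for all `i`,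
there is a positive constant `σ < ε₁` such that `σ < f i t_A − f i t_B`
whenever `0 < t_B`, `t_A ≤ T` and `ε₂ ≤ t_A − t_B`. -/
theorem lemma_one {ι : Type*} (I : Finset ι) (hI : I.Nonempty)
    (τ : ι → ℝ) (hτ : ∀ i ∈ I, 0 < τ i)
    (T ε₁ ε₂ : ℝ) (hT : 0 < T) (hε₁ : 0 < ε₁) (hε₂ : 0 < ε₂) (hε₂T : ε₂ < T)
    (hsmall : ∀ i ∈ I,
      (2 * ε₂) * Real.logb 2 (1 + τ i / (2 * ε₂)) < ε₁) :
    ∃ σ : ℝ, 0 < σ ∧ σ < ε₁ ∧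
      ∀ i ∈ I, ∀ tA tB : ℝ, 0 < tB → tA ≤ T → ε₂ ≤ tA - tB →
        σ < tA * Real.logb 2 (1 + τ i / tA) -
              tB * Real.logb 2 (1 + τ i / tB) := by
  have hlog2 : 0 < Real.log 2 := Real.log_pos one_lt_two
  obtain ⟨j, hj, hmin⟩ := I.exists_min_image (fun i => rateSlope (τ i) T) hI
  have hgap : 0 < ε₂ * rateSlope (τ j) T / Real.log 2 :=
    div_pos (mul_pos hε₂ (rateSlope_pos (hτ j hj) hT)) hlog2
  obtain ⟨σ, hσ, hσlt⟩ := exists_between (lt_min hε₁ hgap)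
  refine ⟨σ, hσ, hσlt.trans_le (min_le_left _ _), fun i hi tA tB hB hAT hAB => ?_⟩
  have hA : 0 < tA := by linarith
  refine (hσlt.trans_le (min_le_right _ _)).trans_le ?_
  rw [Real.logb, Real.logb, ← mul_div_assoc, ← mul_div_assoc, ← sub_div]
  refine div_le_div_of_nonneg_right ?_ hlog2.le
  calc ε₂ * rateSlope (τ j) T ≤ (tA - tB) * rateSlope (τ i) tA :=
        mul_le_mul hAB ((hmin i hi).trans (rateSlope_anti (hτ i hi) hA hAT))
          (rateSlope_pos (hτ j hj) hT).le (hε₂.le.trans hAB)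
    _ ≤ _ := sub_mul_rateSlope_le (hτ i hi) hB hA
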